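/- For every r ≥ 0, (1/2)·exp(−7α𝓡²/3)·r ≤ q(r) ≤ r. -/

import Mathlib

open MeasureTheory Real

/-- The concave reweighting function τ from the Eberle-type construction. -/
noncomputable def tau (R r : ℝ) : ℝ :=
  if r ≤ R then r ^ 2 / 2
  else if r ≤ 2 * R then
    R ^ 2 / 2 + R * (r - R) + (r - R) ^ 2 / 2 - (r - R) ^ 3 / (3 * R)
  else if r ≤ 4 * R then
    5 * R ^ 2 / 3 + R * (r - 2 * R) - (r - 2 * R) ^ 2 / 2 + (r - 2 * R) ^ 3 / (12 * R)
  else 7 * R ^ 2 / 3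

/-- The cutoff function μ. -/
noncomputable def muf (R r : ℝ) : ℝ :=
  if r ≤ R then 1
  else if r ≤ 4 * R then 1 / 2 + 1 / 2 * Real.cos (Real.pi * (r - R) / (3 * R))
  else 0

/-- ψ(r) = exp(−α τ(r)). -/
noncomputable def psi (α R r : ℝ) : ℝ := Real.exp (-(α * tau R r))

/-- Ψ(r) = ∫₀ʳ ψ(s) ds. -/
noncomputable def PsiInt (α R r : ℝ) : ℝ := ∫ s in (0:ℝ)..r, psi α R s

/-- ν(r) = 1 − (1/2) (∫₀ʳ μΨ/ψ) / (∫₀^{4R} μΨ/ψ). -/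
noncomputable def nuf (α R r : ℝ) : ℝ :=
  1 - (1 / 2) * (∫ s in (0:ℝ)..r, muf R s * PsiInt α R s / psi α R s) /
      (∫ s in (0:ℝ)..(4 * R), muf R s * PsiInt α R s / psi α R s)

/-- q(r) = ∫₀ʳ ψ(s) ν(s) ds. -/
noncomputable def qf (α R r : ℝ) : ℝ := ∫ s in (0:ℝ)..r, psi α R s * nuf α R s

theorem tau_cont (R : ℝ) (hR : 0 < R) : Continuous (tau R) := by
  unfold tau
  refine Continuous.if_le (by fun_prop) ?_ continuous_id continuous_const ?_
  · refine Continuous.if_le (by fun_prop) ?_ continuous_id continuous_const ?_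
    · refine Continuous.if_le (by fun_prop) (by fun_prop) continuous_id continuous_const ?_
      intro x hx
      subst hx
      field_simp
      ring
    · intro x hx
      subst hx
      rw [if_pos (by linarith)]
      field_simp
      ring
  · intro x hx
    subst hx
    rw [if_pos (by linarith)]
    simp

theorem muf_cont (R : ℝ) (hR : 0 < R) : Continuous (muf R) := by
  unfold muf
  refine Continuous.if_le (by fun_prop) ?_ continuous_id continuous_const ?_
  · refine Continuous.if_le (by fun_prop) (by fun_prop) continuous_id continuous_const ?_
    intro x hx
    subst hx
    have : Real.pi * (4 * R - R) / (3 * R) = Real.pi := by field_simp; ring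
    rw [this, Real.cos_pi]
    norm_num
  · intro x hx
    subst hx
    rw [if_pos (by linarith)]
    simp
    norm_num

theorem muf_nonneg (R r : ℝ) : 0 ≤ muf R r := by
  unfold muf
  split_ifs
  · norm_num
  · linarith [Real.neg_one_le_cos (Real.pi * (r - R) / (3 * R))]
  · exact le_rfl

theorem tau_nonneg (R r : ℝ) (hR : 0 < R) : 0 ≤ tau R r := by
  unfold tau
  split_ifs with h1 h2 h3
  · positivity
  · push Not at h1
    have : (r - R) ^ 3 / (3 * R) ≤ (r - R) ^ 2 / 2 := by
      rw [div_le_div_iff₀ (by positivity) (by positivity)]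
      nlinarith [mul_nonneg (sq_nonneg (r - R)) (by linarith : 0 ≤ 2 * R - r),
        mul_nonneg (sq_nonneg (r - R)) hR.le]
    have := mul_pos hR (sub_pos.2 h1)
    nlinarith [sq_nonneg R]
  · push Not at h1 h2
    have : 0 ≤ (r - 2 * R) ^ 3 / (12 * R) := by
      have : 0 < r - 2 * R := by linarith
      positivity
    nlinarith [mul_nonneg (by linarith : 0 ≤ r - 2 * R) (by linarith : 0 ≤ 4 * R - r), sq_nonneg R]
  · positivity

theorem tau_le (R r : ℝ) (hR : 0 < R) (hr : 0 ≤ r) : tau R r ≤ 7 * R ^ 2 / 3 := by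
  unfold tau
  split_ifs with h1 h2 h3
  · nlinarith
  · push Not at h1
    have : 0 ≤ (r - R) ^ 3 / (3 * R) := by
      have : 0 < r - R := by linarith
      positivity
    nlinarith [mul_nonneg (by linarith : 0 ≤ r - R) (by linarith : 0 ≤ 2 * R - r)]
  · push Not at h1 h2
    have h : 0 ≤ (4 * R - r) ^ 3 / (12 * R) := by
      have : 0 ≤ 4 * R - r := by linarith
      positivity
    have e : 7 * R ^ 2 / 3 - (5 * R ^ 2 / 3 + R * (r - 2 * R) - (r - 2 * R) ^ 2 / 2
        + (r - 2 * R) ^ 3 / (12 * R)) = (4 * R - r) ^ 3 / (12 * R) := by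
      field_simp
      ring
    linarith
  · exact le_rfl

theorem psi_cont (α R : ℝ) (hR : 0 < R) : Continuous (psi α R) := by
  have := tau_cont R hR
  unfold psi
  fun_prop

theorem integrand_cont (α R : ℝ) (hR : 0 < R) :
    Continuous (fun s => muf R s * PsiInt α R s / psi α R s) := by
  have h1 := muf_cont R hR
  have h2 := psi_cont α R hR
  have h3 : Continuous (PsiInt α R) :=
    intervalIntegral.continuous_primitive (fun a b => h2.intervalIntegrable a b) 0
  exact (h1.mul h3).div h2 (fun x => (Real.exp_pos _).ne')

theorem integrand_nonneg (α R s : ℝ) (hs : 0 ≤ s) :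
    0 ≤ muf R s * PsiInt α R s / psi α R s := by
  refine div_nonneg (mul_nonneg (muf_nonneg R s) ?_) (Real.exp_pos _).le
  exact intervalIntegral.integral_nonneg hs (fun x _ => (Real.exp_pos _).le)

theorem integral_le_full (α R r : ℝ) (hR : 0 < R) (h0 : 0 ≤ r) :
    (∫ s in (0:ℝ)..r, muf R s * PsiInt α R s / psi α R s) ≤
      ∫ s in (0:ℝ)..(4 * R), muf R s * PsiInt α R s / psi α R s := by
  have hi := fun a b => (integrand_cont α R hR).intervalIntegrable (μ := volume) a b
  rcases le_total r (4 * R) with h | h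
  · rw [← intervalIntegral.integral_add_adjacent_intervals (hi 0 r) (hi r (4 * R))]
    have := intervalIntegral.integral_nonneg (μ := volume) h
      (fun x hx => integrand_nonneg α R x (h0.trans hx.1))
    linarith
  · rw [← intervalIntegral.integral_add_adjacent_intervals (hi 0 (4 * R)) (hi (4 * R) r)]
    have : (∫ s in (4 * R)..r, muf R s * PsiInt α R s / psi α R s) = 0 := by
      rw [intervalIntegral.integral_of_le h]
      refine setIntegral_eq_zero_of_forall_eq_zero ?_
      intro x hx
      have h1 := hx.1
      have : muf R x = 0 := by
        unfold muf
        rw [if_neg (by linarith), if_neg (by linarith)]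
      simp [this]
    linarith

theorem nuf_bounds (α R r : ℝ) (hR : 0 < R) (hr : 0 ≤ r) :
    1 / 2 ≤ nuf α R r ∧ nuf α R r ≤ 1 := by
  have h1 := integral_le_full α R r hR hr
  have h2 : 0 ≤ ∫ s in (0:ℝ)..r, muf R s * PsiInt α R s / psi α R s :=
    intervalIntegral.integral_nonneg hr (fun x hx => integrand_nonneg α R x hx.1)
  have h3 := div_le_one_of_le₀ h1 (h2.trans h1)
  have h4 := div_nonneg h2 (h2.trans h1)
  unfold nuf
  rw [mul_div_assoc]
  constructor <;> linarith

theorem nuf_cont (α R : ℝ) (hR : 0 < R) : Continuous (nuf α R) := by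
  have h := intervalIntegral.continuous_primitive (μ := volume)
    (fun a b => (integrand_cont α R hR).intervalIntegrable a b) 0
  unfold nuf
  exact continuous_const.sub ((continuous_const.mul h).div_const _)

theorem q_bounds (α R : ℝ) (hα : 0 < α) (hR : 0 < R) :
    ∀ r : ℝ, 0 ≤ r →
      1 / 2 * Real.exp (-(7 * α * R ^ 2 / 3)) * r ≤ qf α R r ∧ qf α R r ≤ r := by
  intro r hr
  have hc : Continuous (fun s => psi α R s * nuf α R s) :=
    (psi_cont α R hR).mul (nuf_cont α R hR)
  have hi := hc.intervalIntegrable (μ := volume) 0 r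
  unfold qf
  constructor
  · have h := intervalIntegral.integral_mono_on (μ := volume) (a := 0) (b := r)
      (f := fun _ => 1 / 2 * Real.exp (-(7 * α * R ^ 2 / 3))) hr (by simp) hi ?_
    · rw [intervalIntegral.integral_const, smul_eq_mul] at h
      linarith
    · intro x hx
      have h1 : Real.exp (-(7 * α * R ^ 2 / 3)) ≤ psi α R x := by
        unfold psi
        apply Real.exp_le_exp.2
        have := mul_le_mul_of_nonneg_left (tau_le R x hR hx.1) hα.le
        linarith
      rw [mul_comm]
      exact mul_le_mul h1 (nuf_bounds α R x hR hx.1).1 (by norm_num) (Real.exp_pos _).le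
  · have h := intervalIntegral.integral_mono_on (μ := volume) (a := 0) (b := r)
      (g := fun _ => (1 : ℝ)) hr hi (by simp) ?_
    · rw [intervalIntegral.integral_const, smul_eq_mul] at h
      linarith
    · intro x hx
      have h1 : psi α R x ≤ 1 := by
        unfold psi
        apply Real.exp_le_one_iff.2
        have := mul_nonneg hα.le (tau_nonneg R x hR)
        linarith
      have h2 := nuf_bounds α R x hR hx.1
      exact mul_le_one₀ h1 (by linarith) h2.2
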